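/- Let K ⊆ ℝ^n be a nonempty compact set with the property that for every open set S ⊆ ℝ^n with S ∩ K = ∅ that is strictly convex with smooth boundary, the set K ∩ closure(S) is finite. Then for every critical value r > 0 of K there exists ε > 0 such that no number in the open interval (r − ε, r) is a critical value of K. -/

import Mathlib

/-- An open set `S ⊆ ℝⁿ` is strictly convex with smooth boundary: `S` is convex, the open
segment joining any two distinct points of `closure S` lies in `S`, and every frontier point
of `S` admits a unique supporting hyperplane of `closure S` (expressed via a unique supporting
unit functional). -/
def StrictlyConvexSmoothOpen {n : ℕ} (S : Set (EuclideanSpace ℝ (Fin n))) : Prop :=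
  IsOpen S ∧ Convex ℝ S ∧
    (∀ x ∈ closure S, ∀ y ∈ closure S, x ≠ y → openSegment ℝ x y ⊆ S) ∧
    (∀ z ∈ frontier S, ∃! f : EuclideanSpace ℝ (Fin n) →L[ℝ] ℝ,
      ‖f‖ = 1 ∧ ∀ y ∈ closure S, f y ≤ f z)

/-- The gradient inequality for a convex function. -/
theorem ConvexOn.fderiv_sub_le {E : Type*} [NormedAddCommGroup E] [NormedSpace ℝ E]
    {F : E → ℝ} (hF : ConvexOn ℝ Set.univ F) {z : E} (hd : DifferentiableAt ℝ F z) (y : E) :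
    fderiv ℝ F z (y - z) ≤ F y - F z := by
  have hline : HasDerivAt (fun t : ℝ => F (AffineMap.lineMap z y t)) (fderiv ℝ F z (y - z)) 0 := by
    have h1 : HasDerivAt (fun t : ℝ => (AffineMap.lineMap z y t : E)) (y - z) 0 :=
      AffineMap.hasDerivAt_lineMap
    have h2 : HasFDerivAt F (fderiv ℝ F z) ((fun t : ℝ => (AffineMap.lineMap z y t : E)) 0) := by
      simpa using hd.hasFDerivAt
    exact h2.comp_hasDerivAt (0 : ℝ) h1
  have hconv : ConvexOn ℝ Set.univ (fun t : ℝ => F (AffineMap.lineMap z y t)) := by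
    have h := hF.comp_affineMap (AffineMap.lineMap z y : ℝ →ᵃ[ℝ] E)
    rwa [Set.preimage_univ] at h
  have := hconv.le_slope_of_hasDerivAt (Set.mem_univ 0) (Set.mem_univ 1) zero_lt_one hline
  simpa [slope_def_field] using this

/-- A functional that is nonpositive on the open half-space where `g` is negative is a
nonnegative multiple of `g`. -/
theorem eq_smul_of_nonpos_of_neg {E : Type*} [NormedAddCommGroup E] [NormedSpace ℝ E]
    {f g : E →L[ℝ] ℝ} {v : E} (hv : g v < 0) (h : ∀ w, g w < 0 → f w ≤ 0) :
    ∃ c : ℝ, 0 ≤ c ∧ f = c • g := by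
  have key : ∀ w, g w = 0 → f w ≤ 0 := by
    intro w hw
    by_contra! hpos
    have hfv : f v ≤ 0 := h v hv
    have h1 := h (w + (f w / (2 * (1 - f v))) • v) (by
      simp only [map_add, map_smul, smul_eq_mul, hw, zero_add]
      exact mul_neg_of_pos_of_neg (div_pos hpos (by linarith)) hv)
    simp only [map_add, map_smul, smul_eq_mul] at h1
    have h2 : f w / (2 * (1 - f v)) * f v = f w / 2 * (f v / (1 - f v)) := by
      field_simp
    have h3 : -1 ≤ f v / (1 - f v) := by
      rw [le_div_iff₀ (by linarith)]; linarith
    nlinarith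
  refine ⟨f v / g v, div_nonneg_of_nonpos (h v hv) hv.le, ?_⟩
  ext w
  have hw : g (w - (g w / g v) • v) = 0 := by
    simp [hv.ne]
  have h1 := key _ hw
  have h2 := key (-(w - (g w / g v) • v)) (by rw [map_neg, hw, neg_zero])
  simp only [map_sub, map_neg, map_smul, smul_eq_mul] at h1 h2
  have : f w = g w / g v * f v := by linarith
  rw [this]
  simp only [smul_apply, smul_eq_mul]
  ring

theorem StrictConvexOn.le_zero_mem_closure_lt_zero {E : Type*} [NormedAddCommGroup E]
    [NormedSpace ℝ E] {F : E → ℝ} (hF : StrictConvexOn ℝ Set.univ F) {x y₀ : E}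
    (h₀ : F y₀ < 0) (hx : F x ≤ 0) : x ∈ closure {y | F y < 0} := by
  rcases eq_or_ne x y₀ with rfl | hne
  · exact subset_closure h₀
  have hsub : openSegment ℝ x y₀ ⊆ {y | F y < 0} := by
    rintro z ⟨a, b, ha, hb, hab, rfl⟩
    have := hF.2 (Set.mem_univ x) (Set.mem_univ y₀) hne ha hb hab
    simp only [smul_eq_mul] at this
    show F _ < 0
    nlinarith
  exact closure_mono hsub (segment_subset_closure_openSegment (left_mem_segment ℝ x y₀))

/-- Strict sublevel sets of differentiable strictly convex functions are strictly convex with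
smooth boundary. -/
theorem StrictConvexOn.strictlyConvexSmoothOpen {n : ℕ} {F : EuclideanSpace ℝ (Fin n) → ℝ}
    (hF : StrictConvexOn ℝ Set.univ F) (hd : Differentiable ℝ F)
    {y₀ : EuclideanSpace ℝ (Fin n)} (h₀ : F y₀ < 0) :
    StrictlyConvexSmoothOpen {y | F y < 0} := by
  have hopen : IsOpen {y | F y < 0} := isOpen_lt hd.continuous continuous_const
  have hcl : closure {y | F y < 0} ⊆ {y | F y ≤ 0} :=
    closure_minimal (fun y (hy : F y < 0) => hy.le) (isClosed_le hd.continuous continuous_const)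
  refine ⟨hopen, by simpa using hF.convexOn.convex_lt 0, ?_, ?_⟩
  · rintro x hx y hy hne z ⟨a, b, ha, hb, hab, rfl⟩
    have h1 := hF.2 (Set.mem_univ x) (Set.mem_univ y) hne ha hb hab
    have hx' : F x ≤ 0 := hcl hx
    have hy' : F y ≤ 0 := hcl hy
    simp only [smul_eq_mul] at h1
    show F _ < 0
    nlinarith
  · intro z hz
    rw [hopen.frontier_eq] at hz
    have hz0 : F z = 0 := le_antisymm (hcl hz.1) (not_lt.1 hz.2)
    set g := fderiv ℝ F z with hg
    have hgrad : ∀ y, g (y - z) ≤ F y := fun y => by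
      have h := hF.convexOn.fderiv_sub_le (hd z) y
      rwa [hz0, sub_zero] at h
    have hv : g (y₀ - z) < 0 := (hgrad y₀).trans_lt h₀
    have hg0 : 0 < ‖g‖ := norm_pos_iff.2 fun h => by simp [h] at hv
    refine ⟨‖g‖⁻¹ • g, ⟨?_, ?_⟩, ?_⟩
    · rw [norm_smul, norm_inv, norm_norm, inv_mul_cancel₀ hg0.ne']
    · intro y hy
      have h1 : g y - g z ≤ 0 := by rw [← map_sub]; exact (hgrad y).trans (hcl hy)
      simp only [smul_apply, smul_eq_mul]
      exact mul_le_mul_of_nonneg_left (by linarith) (by positivity)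
    · rintro f ⟨hf1, hf⟩
      have hneg : ∀ w, g w < 0 → f w ≤ 0 := by
        intro w hw
        have hderiv : HasDerivAt (fun t : ℝ => F (z + t • w)) (g w) 0 := by
          have h1 : HasDerivAt (fun t : ℝ => z + t • w) w 0 := by
            simpa using ((hasDerivAt_id (0 : ℝ)).smul_const w).const_add z
          have h2 : HasFDerivAt F g ((fun t : ℝ => z + t • w) 0) := by
            simpa using (hd z).hasFDerivAt
          exact h2.comp_hasDerivAt (0 : ℝ) h1
        have hev : ∀ᶠ t in nhdsWithin (0 : ℝ) (Set.Ioi 0),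
            slope (fun t : ℝ => F (z + t • w)) 0 t < 0 :=
          ((hasDerivAt_iff_tendsto_slope.1 hderiv).mono_left
            (nhdsWithin_mono _ fun t (ht : 0 < t) => ht.ne')).eventually_lt_const hw
        obtain ⟨t, ht, ht0⟩ := (hev.and self_mem_nhdsWithin).exists
        have ht0' : (0 : ℝ) < t := ht0
        have hFt : F (z + t • w) < 0 := by
          simp only [slope_def_field, zero_smul, add_zero, hz0, sub_zero] at ht
          exact (div_neg_iff.1 ht).resolve_left (fun h => (h.2.trans ht0').false) |>.1
        have := hf _ (subset_closure hFt)
        simp only [map_add, map_smul, smul_eq_mul] at this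
        by_contra! hpos
        nlinarith [mul_pos ht0' hpos]
      obtain ⟨c, hc, rfl⟩ := eq_smul_of_nonpos_of_neg hv hneg
      rw [norm_smul, Real.norm_of_nonneg hc] at hf1
      rw [eq_inv_of_mul_eq_one_left hf1]

theorem StrictConvexOn.comp_norm_sub {E : Type*} [NormedAddCommGroup E] [NormedSpace ℝ E]
    [StrictConvexSpace ℝ E] {φ : ℝ → ℝ} (hφ : StrictConvexOn ℝ Set.univ φ)
    (hmono : StrictMonoOn φ (Set.Ici 0)) (a : E) :
    StrictConvexOn ℝ Set.univ fun y : E => φ ‖y - a‖ := by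
  refine ⟨convex_univ, fun x _ y _ hxy α β hα hβ hαβ => ?_⟩
  have hsplit : α • x + β • y - a = α • (x - a) + β • (y - a) := by
    rw [smul_sub, smul_sub, sub_add_sub_comm, ← add_smul, hαβ, one_smul]
  have hxy' : x - a ≠ y - a := fun h => hxy (sub_left_injective h)
  simp only [hsplit]
  rcases eq_or_ne ‖x - a‖ ‖y - a‖ with heq | hne
  · rw [heq, ← add_smul, hαβ, one_smul]
    exact hmono (norm_nonneg _) (norm_nonneg _)
      (norm_combo_lt_of_ne heq.le le_rfl hxy' hα hβ hαβ)
  · refine lt_of_le_of_lt (hmono.monotoneOn (norm_nonneg _) ?_ ?_)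
      (hφ.2 (Set.mem_univ _) (Set.mem_univ _) hne hα hβ hαβ)
    · exact add_nonneg (mul_nonneg hα.le (norm_nonneg _)) (mul_nonneg hβ.le (norm_nonneg _))
    · refine (norm_add_le _ _).trans_eq ?_
      rw [norm_smul, norm_smul, Real.norm_of_nonneg hα.le, Real.norm_of_nonneg hβ.le]
      rfl

theorem differentiable_comp_norm_sub {E : Type*} [NormedAddCommGroup E] [InnerProductSpace ℝ E]
    {φ : ℝ → ℝ} (hφ : Differentiable ℝ φ) (h0 : deriv φ 0 = 0) (a : E) :
    Differentiable ℝ fun y : E => φ ‖y - a‖ := by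
  intro y
  rcases eq_or_ne y a with rfl | hne
  · have h1 : HasDerivAt φ 0 0 := by
      have h := (hφ 0).hasDerivAt
      rwa [h0] at h
    have h2 : Filter.Tendsto (fun z : E => ‖z - y‖) (nhds y) (nhds 0) := by
      have : Continuous fun z : E => ‖z - y‖ := by fun_prop
      simpa using this.tendsto y
    have h3 := (hasDerivAt_iff_isLittleO.1 h1).comp_tendsto h2
    refine HasFDerivAt.differentiableAt (f' := 0) ?_
    rw [hasFDerivAt_iff_isLittleO]
    simpa [Function.comp_def] using h3
  · have h1 : DifferentiableAt ℝ (fun z : E => ‖z - a‖) y :=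
      (differentiableAt_id.sub_const a).norm ℝ (sub_ne_zero.2 hne)
    exact (hφ _).comp y h1

/-- A `C¹` quadratic spline supported on `[p, p + 4ρ]`, equal to `(s - p)²` on `[p, p + ρ]`. -/
noncomputable def dent (p ρ s : ℝ) : ℝ :=
  max (s - p) 0 ^ 2 - 2 * max (s - p - ρ) 0 ^ 2 + 2 * max (s - p - 3 * ρ) 0 ^ 2
    - max (s - p - 4 * ρ) 0 ^ 2

/-- Half the derivative of `dent p ρ`: a triangle wave. -/
noncomputable def triangleWave (p ρ s : ℝ) : ℝ :=
  max (s - p) 0 - 2 * max (s - p - ρ) 0 + 2 * max (s - p - 3 * ρ) 0 - max (s - p - 4 * ρ) 0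

theorem hasDerivAt_max_zero_sq (x : ℝ) : HasDerivAt (fun x : ℝ => max x 0 ^ 2) (2 * max x 0) x := by
  rcases lt_trichotomy x 0 with hx | rfl | hx
  · rw [max_eq_right hx.le, mul_zero]
    refine (hasDerivAt_const x (0 : ℝ)).congr_of_eventuallyEq ?_
    filter_upwards [gt_mem_nhds hx] with y hy
    rw [max_eq_right hy.le]; simp
  · rw [max_self, mul_zero, hasDerivAt_iff_isLittleO]
    have h : (fun x : ℝ => x ^ 2) =o[nhds 0] fun x : ℝ => x := by
      simpa using Asymptotics.isLittleO_pow_pow (𝕜 := ℝ) (m := 1) (n := 2) (by norm_num)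
    refine (Asymptotics.IsBigO.of_norm_le fun y => ?_).trans_isLittleO (h.congr_right fun y => by simp)
    simp only [max_self, smul_zero, sub_zero, ne_eq, OfNat.ofNat_ne_zero, not_false_eq_true, zero_pow]
    rw [Real.norm_of_nonneg (by positivity), ← sq_abs y]
    exact pow_le_pow_left₀ (le_max_right _ _) (max_le (le_abs_self y) (abs_nonneg y)) 2
  · rw [max_eq_left hx.le]
    have h := hasDerivAt_pow 2 x
    simp only [Nat.cast_ofNat, Nat.add_one_sub_one, pow_one] at h
    refine h.congr_of_eventuallyEq ?_
    filter_upwards [lt_mem_nhds hx] with y hy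
    rw [max_eq_left hy.le]

theorem hasDerivAt_dent (p ρ s : ℝ) : HasDerivAt (dent p ρ) (2 * triangleWave p ρ s) s := by
  have h : ∀ q : ℝ, HasDerivAt (fun s : ℝ => max (s - q) 0 ^ 2) (2 * max (s - q) 0) s := fun q => by
    simpa using (hasDerivAt_max_zero_sq (s - q)).comp_sub_const s q
  unfold dent triangleWave
  simp only [sub_sub]
  refine ((((h p).sub ((h (p + ρ)).const_mul 2)).add ((h (p + 3 * ρ)).const_mul 2)).sub
    (h (p + 4 * ρ))).congr_deriv ?_
  ring

theorem dent_eq_zero_of_notMem {p ρ s : ℝ} (hρ : 0 < ρ) (hs : s ∉ Set.Ioo p (p + 4 * ρ)) :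
    dent p ρ s = 0 := by
  unfold dent
  rcases le_or_gt s p with h | h
  · simp only [max_eq_right (show s - p ≤ 0 by linarith),
      max_eq_right (show s - p - ρ ≤ 0 by linarith),
      max_eq_right (show s - p - 3 * ρ ≤ 0 by linarith),
      max_eq_right (show s - p - 4 * ρ ≤ 0 by linarith)]
    ring
  · have h' : p + 4 * ρ ≤ s := not_lt.1 fun h' => hs ⟨h, h'⟩
    simp only [max_eq_left (show 0 ≤ s - p by linarith),
      max_eq_left (show 0 ≤ s - p - ρ by linarith),
      max_eq_left (show 0 ≤ s - p - 3 * ρ by linarith),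
      max_eq_left (show 0 ≤ s - p - 4 * ρ by linarith)]
    ring

theorem dent_add (p : ℝ) {ρ : ℝ} (hρ : 0 < ρ) : dent p ρ (p + ρ) = ρ ^ 2 := by
  unfold dent
  simp only [max_eq_left (show 0 ≤ p + ρ - p by linarith),
    max_eq_right (show p + ρ - p - ρ ≤ 0 by linarith),
    max_eq_right (show p + ρ - p - 3 * ρ ≤ 0 by linarith),
    max_eq_right (show p + ρ - p - 4 * ρ ≤ 0 by linarith)]
  ring

theorem triangleWave_eq_zero_of_notMem {p ρ s : ℝ} (hρ : 0 < ρ)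
    (hs : s ∉ Set.Ioo p (p + 4 * ρ)) : triangleWave p ρ s = 0 := by
  unfold triangleWave
  simp only [Set.mem_Ioo, not_and_or, not_lt] at hs
  rcases hs with h | h <;> grind

theorem triangleWave_sub_le {p ρ s t : ℝ} (hρ : 0 < ρ) (hst : s ≤ t) :
    |triangleWave p ρ t - triangleWave p ρ s| ≤ t - s := by
  unfold triangleWave
  grind

theorem abs_triangleWave_le {p ρ : ℝ} (hρ : 0 < ρ) (s : ℝ) : |triangleWave p ρ s| ≤ ρ := by
  unfold triangleWave
  grind

/-- Carving pairwise disjoint dents out of `s ↦ s ^ 2` yields a differentiable function with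
strictly increasing derivative. -/
theorem exists_dented_sq {p ρ c : ℕ → ℝ} (hp : ∀ k, 0 < p k) (hρ : ∀ k, 0 < ρ k)
    (hc : ∀ k, c k ∈ Set.Ico (0 : ℝ) 1) (hsep : ∀ i j, i < j → p j + 4 * ρ j ≤ p i)
    (hsum : Summable ρ) :
    ∃ φ : ℝ → ℝ, Differentiable ℝ φ ∧ StrictMono (deriv φ) ∧ deriv φ 0 = 0 ∧
      (∀ s k, s ∈ Set.Ioo (p k) (p k + 4 * ρ k) → φ s = s ^ 2 - c k * dent (p k) (ρ k) s) ∧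
      (∀ s, (∀ k, s ∉ Set.Ioo (p k) (p k + 4 * ρ k)) → φ s = s ^ 2) := by
  have hdisj : ∀ s k, s ∈ Set.Ioo (p k) (p k + 4 * ρ k) → ∀ j, j ≠ k →
      s ∉ Set.Ioo (p j) (p j + 4 * ρ j) := by
    rintro s k ⟨h1, h2⟩ j hj ⟨h3, h4⟩
    rcases lt_or_gt_of_ne hj with h | h
    · linarith [hsep j k h]
    · linarith [hsep k j h]
  have hact : ∀ s, ∃ k, ∀ j, j ≠ k → s ∉ Set.Ioo (p j) (p j + 4 * ρ j) := by
    intro s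
    by_cases h : ∃ k, s ∈ Set.Ioo (p k) (p k + 4 * ρ k)
    · obtain ⟨k, hk⟩ := h
      exact ⟨k, hdisj s k hk⟩
    · exact ⟨0, fun j _ hj => h ⟨j, hj⟩⟩
  have hzero : ∀ k, (0 : ℝ) ∉ Set.Ioo (p k) (p k + 4 * ρ k) := fun k h => (hp k).not_gt h.1
  set v : ℕ → ℝ → ℝ := fun k s => c k * triangleWave (p k) (ρ k) s with hv
  have hvz : ∀ k s, s ∉ Set.Ioo (p k) (p k + 4 * ρ k) → v k s = 0 := fun k s hs => by
    simp only [hv, triangleWave_eq_zero_of_notMem (hρ k) hs, mul_zero]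
  have hvlip : ∀ k s t, s < t → |v k t - v k s| < t - s := by
    intro k s t hst
    have h := triangleWave_sub_le (p := p k) (hρ k) hst.le
    simp only [hv]
    rw [← mul_sub, abs_mul, abs_of_nonneg (hc k).1]
    nlinarith [(hc k).1, (hc k).2, abs_nonneg (triangleWave (p k) (ρ k) t -
      triangleWave (p k) (ρ k) s)]
  have hderiv : ∀ s, HasDerivAt (fun s => s ^ 2 - ∑' k, c k * dent (p k) (ρ k) s)
      (2 * s - ∑' k, 2 * v k s) s := by
    intro s
    have h1 : HasDerivAt (fun s => ∑' k, c k * dent (p k) (ρ k) s) (∑' k, 2 * v k s) s := by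
      refine hasDerivAt_tsum (g := fun k s => c k * dent (p k) (ρ k) s)
        (g' := fun k s => 2 * v k s) (u := fun k => 2 * ρ k) (y₀ := 0) (hsum.mul_left 2) (fun k y => ?_)
        (fun k y => ?_) ?_ s
      · exact ((hasDerivAt_dent (p k) (ρ k) y).const_mul (c k)).congr_deriv (by simp only [hv]; ring)
      · have h := abs_triangleWave_le (p := p k) (hρ k) y
        simp only [hv, Real.norm_eq_abs, abs_mul, abs_two, abs_of_nonneg (hc k).1]
        nlinarith [(hc k).1, (hc k).2, abs_nonneg (triangleWave (p k) (ρ k) y)]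
      · simp only [dent_eq_zero_of_notMem (hρ _) (hzero _), mul_zero]
        exact summable_zero
    have h2 := hasDerivAt_pow 2 s
    simp only [Nat.cast_ofNat, Nat.add_one_sub_one, pow_one] at h2
    exact h2.sub h1
  have hdv : ∀ s k, (∀ j, j ≠ k → s ∉ Set.Ioo (p j) (p j + 4 * ρ j)) →
      ∑' j, 2 * v j s = 2 * v k s := fun s k hk =>
    tsum_eq_single k fun j hj => by rw [hvz j s (hk j hj), mul_zero]
  refine ⟨_, fun s => (hderiv s).differentiableAt, ?_, ?_, ?_, ?_⟩
  · intro s t hst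
    rw [(hderiv s).deriv, (hderiv t).deriv]
    obtain ⟨i, hi⟩ := hact s
    obtain ⟨j, hj⟩ := hact t
    rw [hdv s i hi, hdv t j hj]
    rcases eq_or_ne i j with rfl | hij
    · linarith [(abs_lt.1 (hvlip i s t hst)).2]
    have hvi : v i t = 0 := hvz i t (hj i hij)
    have hvj : v j s = 0 := hvz j s (hi j hij.symm)
    have h1 := abs_lt.1 (hvlip i s t hst)
    have h2 := abs_lt.1 (hvlip j s t hst)
    rw [hvi] at h1
    rw [hvj] at h2
    by_cases hs : s ∈ Set.Ioo (p i) (p i + 4 * ρ i)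
    · by_cases ht : t ∈ Set.Ioo (p j) (p j + 4 * ρ j)
      · have hlt : j < i := by
          by_contra! h
          linarith [hsep i j (lt_of_le_of_ne h hij), hs.1, ht.2]
        have hx := hsep j i hlt
        have h3 := (abs_lt.1 (hvlip i s _ hs.2)).2
        have h4 : v j t - v j (p j) < t - p j := (abs_lt.1 (hvlip j _ t ht.1)).2
        rw [hvz i _ fun h => lt_irrefl _ h.2] at h3
        rw [hvz j _ fun h => lt_irrefl _ h.1] at h4
        linarith
      · rw [hvz j t ht]; linarith
    · rw [hvz i s hs]; linarith
  · rw [(hderiv 0).deriv]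
    simp [hvz _ 0 (hzero _)]
  · intro s k hs
    rw [tsum_eq_single k fun j hj => by
      rw [dent_eq_zero_of_notMem (hρ j) (hdisj s k hs j hj), mul_zero]]
  · intro s hs
    simp [dent_eq_zero_of_notMem (hρ _) (hs _)]

/-- A strictly convex radial profile minus an affine function is strictly convex and
differentiable. -/
theorem strictConvexOn_and_differentiable_radial {n : ℕ} {φ : ℝ → ℝ} (hd : Differentiable ℝ φ)
    (hmono : StrictMono (deriv φ)) (h0 : deriv φ 0 = 0) (a e : EuclideanSpace ℝ (Fin n)) (c : ℝ) :
    StrictConvexOn ℝ Set.univ (fun y => φ ‖y - a‖ - (inner ℝ (a - y) e + c)) ∧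
      Differentiable ℝ (fun y => φ ‖y - a‖ - (inner ℝ (a - y) e + c)) := by
  have hφ : StrictConvexOn ℝ Set.univ φ := hmono.strictConvexOn_univ_of_deriv hd.continuous
  have hφmono : StrictMonoOn φ (Set.Ici 0) := by
    refine strictMonoOn_of_deriv_pos (convex_Ici 0) hd.continuous.continuousOn fun s hs => ?_
    rw [interior_Ici] at hs
    exact h0 ▸ hmono hs
  refine ⟨(hφ.comp_norm_sub hφmono a).sub_concaveOn ⟨convex_univ, fun x _ y _ α β _ _ hαβ => ?_⟩,
    (differentiable_comp_norm_sub hd h0 a).sub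
      (((differentiable_id.const_sub a).inner ℝ (differentiable_const e)).add_const c)⟩
  refine le_of_eq ?_
  simp only [inner_sub_left, inner_add_left, real_inner_smul_left, smul_eq_mul]
  linear_combination (inner ℝ a e + c) * hαβ

/-- The largest admissible amplitude of a dent: the obstacle `K` is touched, but not crossed. -/
theorem exists_amplitude {X : Type*} [TopologicalSpace X] {C : Set X} (hC : IsCompact C)
    {f d : X → ℝ} (hf : Continuous f) (hd : Continuous d) (hpos : ∀ y ∈ C, 0 < f y)
    {θ : ℝ} (hθ : 0 ≤ θ) {b : X} (hb : b ∈ C) (hfb : f b ≤ θ * d b) :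
    ∃ c ∈ Set.Icc 0 θ, (∀ y ∈ C, c * d y ≤ f y) ∧ ∃ y ∈ C, f y = c * d y := by
  have hK : IsCompact ((Set.Icc 0 θ ×ˢ C) ∩ {q : ℝ × X | f q.2 ≤ q.1 * d q.2}) :=
    (isCompact_Icc.prod hC).inter_right (isClosed_le (by fun_prop) (by fun_prop))
  obtain ⟨⟨c, y⟩, ⟨⟨hc, hy⟩, hle⟩, hmin⟩ :=
    hK.exists_isMinOn ⟨(θ, b), ⟨⟨⟨hθ, le_rfl⟩, hb⟩, hfb⟩⟩ continuous_fst.continuousOn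
  simp only [Set.mem_ofPred_eq] at hle hc hy
  have key : ∀ z ∈ C, c * d z ≤ f z := by
    intro z hz
    by_contra! hlt
    have hfz := hpos z hz
    have hdz : 0 < d z := by
      by_contra! h
      nlinarith [hc.1]
    have hq : f z / d z < c := (div_lt_iff₀ hdz).2 hlt
    have : c ≤ f z / d z := hmin (a := (f z / d z, z))
      ⟨⟨⟨by positivity, hq.le.trans hc.2⟩, hz⟩, (div_mul_cancel₀ _ hdz.ne').ge⟩
    linarith
  exact ⟨c, hc, key, y, hy, le_antisymm hle (key y hy)⟩

/-- If a compact set `K` stays outside a ball through `a ∈ K`, and accumulates at `a` from below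
the tangent hyperplane, then some strictly convex body touches `K` infinitely often. -/
theorem exists_infinite_contact {n : ℕ} {K : Set (EuclideanSpace ℝ (Fin n))} (hK : IsCompact K)
    {a e : EuclideanSpace ℝ (Fin n)} (hout : ∀ y ∈ K, y ≠ a → inner ℝ (a - y) e < ‖y - a‖ ^ 2)
    (hacc : ∀ η > 0, ∃ b ∈ K, ‖b - a‖ < η ∧ 0 < inner ℝ (a - b) e) :
    ∃ S, StrictlyConvexSmoothOpen S ∧ S ∩ K = ∅ ∧ (K ∩ closure S).Infinite := by
  set σ : EuclideanSpace ℝ (Fin n) → ℝ := fun y => ‖y - a‖ with hσ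
  set h : EuclideanSpace ℝ (Fin n) → ℝ := fun y => inner ℝ (a - y) e with hh
  have hσc : Continuous σ := by fun_prop
  have hhc : Continuous h := by fun_prop
  set P : EuclideanSpace ℝ (Fin n) → ℝ := fun y => h y / (3 * σ y) with hP
  have hprop : ∀ b ∈ K, 0 < h b → 0 < P b ∧ P b < σ b / 3 ∧ 0 < σ b := by
    intro b hb hpos
    have hne : b ≠ a := by
      rintro rfl
      simp [hh] at hpos
    have hσpos : 0 < σ b := norm_pos_iff.2 (sub_ne_zero.2 hne)
    refine ⟨by positivity, ?_, hσpos⟩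
    have := hout b hb hne
    change h b < σ b ^ 2 at this
    rw [hP]
    simp only
    rw [div_lt_div_iff₀ (by positivity) (by norm_num)]
    nlinarith
  obtain ⟨b, hb, hbsep⟩ := exists_seq_of_forall_finset_exists
    (fun y => y ∈ K ∧ 0 < h y) (fun x y => 4 * σ y ≤ P x) (by
      intro s hs
      obtain ⟨δ, hδ, hδs⟩ : ∃ δ > 0, ∀ x ∈ s, δ ≤ P x := by
        rcases s.eq_empty_or_nonempty with rfl | hne
        · exact ⟨1, one_pos, by simp⟩
        · obtain ⟨x, hx, hmin⟩ := s.exists_min_image P hne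
          exact ⟨P x, (hprop x (hs x hx).1 (hs x hx).2).1, hmin⟩
      obtain ⟨b, hbK, hbδ, hbpos⟩ := hacc (δ / 4) (by positivity)
      refine ⟨b, ⟨hbK, hbpos⟩, fun x hx => ?_⟩
      have : σ b < δ / 4 := hbδ
      linarith [hδs x hx])
  have hbp := fun k => hprop (b k) (hb k).1 (hb k).2
  set p : ℕ → ℝ := fun k => P (b k) with hp
  set ρ : ℕ → ℝ := fun k => σ (b k) - p k with hρ
  have hρpos : ∀ k, 0 < ρ k := fun k => by
    have := hbp k
    simp only [hρ, hp]; linarith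
  have hsep : ∀ i j, i < j → p j + 4 * ρ j ≤ p i := fun i j hij => by
    have h1 := hbsep i j hij
    have h2 := hbp j
    simp only [hρ, hp]; linarith
  have hsum : Summable ρ := by
    have hgeo : ∀ k, σ (b k) ≤ σ (b 0) * (1 / 4) ^ k := by
      intro k
      induction k with
      | zero => simp
      | succ k ih =>
        have h1 := hbsep k (k + 1) k.lt_succ_self
        have h2 := hbp k
        rw [pow_succ]
        linarith
    refine Summable.of_nonneg_of_le (fun k => (hρpos k).le) (fun k => ?_)
      ((summable_geometric_of_lt_one (by norm_num) (by norm_num)).mul_left (σ (b 0)) :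
        Summable fun k => σ (b 0) * (1 / 4 : ℝ) ^ k)
    have := hbp k
    simp only [hρ, hp]
    linarith [hgeo k]
  have hamp : ∀ k, ∃ c ∈ Set.Ico (0 : ℝ) 1,
      (∀ y ∈ K, σ y ∈ Set.Icc (p k) (p k + 4 * ρ k) →
        c * dent (p k) (ρ k) (σ y) ≤ σ y ^ 2 - h y) ∧
      ∃ y ∈ K, σ y ∈ Set.Ioo (p k) (p k + 4 * ρ k) ∧
        σ y ^ 2 - h y = c * dent (p k) (ρ k) (σ y) := by
    intro k
    obtain ⟨hp0, hp3, hσ0⟩ := hbp k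
    have hpos : ∀ y ∈ K ∩ σ ⁻¹' Set.Icc (p k) (p k + 4 * ρ k), 0 < σ y ^ 2 - h y := by
      rintro y ⟨hyK, hy, -⟩
      have hya : y ≠ a := by
        rintro rfl
        have : σ y = 0 := by simp [hσ]
        linarith
      exact sub_pos.2 (hout y hyK hya)
    have hdc : Continuous fun y => dent (p k) (ρ k) (σ y) := by
      unfold dent; fun_prop
    have hσb : σ (b k) = p k + ρ k := by simp [hρ]
    have hhb : h (b k) = 3 * σ (b k) * p k := by
      simp only [hp, hP]; field_simp
    have hθ : p k / σ (b k) < 1 := by rw [div_lt_one hσ0]; linarith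
    have hθ0 : 0 < p k / σ (b k) := div_pos hp0 hσ0
    obtain ⟨c, hc, hle, y, hy, hyeq⟩ := exists_amplitude
      (hK.inter_right (isClosed_Icc.preimage hσc)) (f := fun y => σ y ^ 2 - h y)
      (by fun_prop) hdc hpos (θ := 1 - p k / σ (b k)) (by linarith) (b := b k)
      ⟨(hb k).1, by rw [Set.mem_preimage, hσb]; constructor <;> linarith [hρpos k]⟩ (by
        rw [hhb, hσb, dent_add _ (hρpos k), ← hσb]
        have hρσ : ρ k = σ (b k) * (1 - p k / σ (b k)) := by
          simp only [hρ]; field_simp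
        rw [hρσ]
        have hpσ : p k = σ (b k) * (p k / σ (b k)) := by field_simp
        generalize p k / σ (b k) = κ at *
        rw [hpσ]
        have : 0 ≤ σ (b k) ^ 2 * (κ ^ 2 * (3 - κ)) := by
          have : 0 ≤ 3 - κ := by linarith
          positivity
        nlinarith)
    refine ⟨c, ⟨hc.1, by linarith [hc.2]⟩, fun y hyK hy => hle y ⟨hyK, hy⟩, y, hy.1, ?_, hyeq⟩
    by_contra hnot
    have := hpos y hy
    rw [hyeq, dent_eq_zero_of_notMem (hρpos k) hnot, mul_zero] at this
    exact lt_irrefl _ this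
  choose c hc hcle z hzK hzI hz using hamp
  obtain ⟨φ, hφd, hφm, hφ0, hφin, hφout⟩ :=
    exists_dented_sq (fun k => (hbp k).1) hρpos hc hsep hsum
  obtain ⟨hconv, hdiff⟩ := strictConvexOn_and_differentiable_radial hφd hφm hφ0 a e 0
  set F : EuclideanSpace ℝ (Fin n) → ℝ := fun y => φ ‖y - a‖ - (inner ℝ (a - y) e + 0) with hF
  have hFeq : ∀ y, F y = φ (σ y) - h y := fun y => by simp [hF, hσ, hh]
  have hFz : ∀ k, F (z k) = 0 := fun k => by
    rw [hFeq, hφin _ k (hzI k), ← hz k]; ring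
  have hzne : ∀ i j, i < j → σ (z j) < σ (z i) := fun i j hij =>
    ((hzI j).2.trans_le (hsep i j hij)).trans (hzI i).1
  have hneg : F (midpoint ℝ (z 0) (z 1)) < 0 := by
    have hne : z 0 ≠ z 1 := fun heq => by
      have := hzne 0 1 one_pos
      rw [heq] at this
      exact lt_irrefl _ this
    have := hconv.2 (Set.mem_univ (z 0)) (Set.mem_univ (z 1)) hne 
      one_half_pos one_half_pos (add_halves 1)
    rw [hFz, hFz, smul_zero, add_zero, ← smul_add] at this
    rwa [midpoint_eq_smul_add, invOf_eq_inv, ← one_div]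
  refine ⟨_, hconv.strictlyConvexSmoothOpen hdiff hneg, ?_, ?_⟩
  · rw [Set.eq_empty_iff_forall_notMem]
    rintro y ⟨hyF, hyK⟩
    have hyF' : F y < 0 := hyF
    rw [hFeq] at hyF'
    by_cases hex : ∃ k, σ y ∈ Set.Ioo (p k) (p k + 4 * ρ k)
    · obtain ⟨k, hk⟩ := hex
      rw [hφin _ k hk] at hyF'
      linarith [hcle k y hyK (Set.Ioo_subset_Icc_self hk)]
    · rw [hφout _ fun k hk => hex ⟨k, hk⟩] at hyF'
      rcases eq_or_ne y a with rfl | hya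
      · simp [hσ, hh] at hyF'
      · have : h y < σ y ^ 2 := hout y hyK hya
        linarith
  · have hanti : StrictAnti fun k => σ (z k) := fun i j hij => hzne i j hij
    have hinj : Function.Injective z := Function.Injective.of_comp (f := σ) hanti.injective
    refine (Set.infinite_range_of_injective hinj).mono ?_
    rintro _ ⟨k, rfl⟩
    exact ⟨hzK k, hconv.le_zero_mem_closure_lt_zero hneg (hFz k).le⟩

theorem exists_inner_sub_nonpos_of_mem_convexHull {E : Type*} [NormedAddCommGroup E]
    [InnerProductSpace ℝ E] {A : Set E} {x : E} (hx : x ∈ convexHull ℝ A) (v : E) :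
    ∃ a ∈ A, inner ℝ (a - x) v ≤ 0 := by
  by_contra! h
  have hconv : Convex ℝ {y | inner ℝ v x < inner ℝ v y} :=
    convex_halfSpace_gt (innerSL ℝ v).isLinear _
  have hsub : A ⊆ {y | inner ℝ v x < inner ℝ v y} := fun a ha => by
    have := h a ha
    rw [inner_sub_left, real_inner_comm v a, real_inner_comm v x] at this
    exact sub_pos.1 this
  exact lt_irrefl (inner ℝ v x) (convexHull_min hsub hconv hx)

/-- Points almost in the convex hull of a subset of a finite set are in that hull. -/
theorem Set.Finite.exists_pos_forall_mem_convexHull {E : Type*} [NormedAddCommGroup E]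
    [NormedSpace ℝ E] {N : Set E} (hN : N.Finite) (x : E) :
    ∃ γ > 0, ∀ A ⊆ N, x ∈ Metric.thickening γ (convexHull ℝ A) → x ∈ convexHull ℝ A := by
  have h : ∀ A ∈ {A | A ⊆ N}, ∃ γ > 0, ∀ γ' ≤ γ,
      x ∈ Metric.thickening γ' (convexHull ℝ A) → x ∈ convexHull ℝ A := by
    intro A hA
    by_cases hx : x ∈ convexHull ℝ A
    · exact ⟨1, one_pos, fun _ _ _ => hx⟩
    · have hcl : IsClosed (convexHull ℝ A) := (hN.subset hA).isClosed_convexHull ℝ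
      rcases (convexHull ℝ A).eq_empty_or_nonempty with hemp | hne
      · exact ⟨1, one_pos, fun γ _ h => by simp [hemp] at h⟩
      · refine ⟨Metric.infDist x (convexHull ℝ A), (hcl.notMem_iff_infDist_pos hne).1 hx,
          fun γ hγ h => ?_⟩
        rw [Metric.mem_thickening_iff_infDist_lt hne] at h
        exact absurd h hγ.not_gt
  choose! γ hγ hγA using h
  obtain ⟨δ, hδ, hδA⟩ : ∃ δ > 0, ∀ A ∈ {A | A ⊆ N}, δ ≤ γ A := by
    obtain ⟨A, hA, hmin⟩ := Set.exists_min_image _ γ hN.finite_subsets ⟨∅, Set.empty_subset N⟩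
    exact ⟨γ A, hγ A hA, hmin⟩
  exact ⟨δ, hδ, fun A hA => hγA A hA δ (hδA A hA)⟩

theorem IsCompact.exists_pos_forall_dist_lt {E : Type*} [MetricSpace E] {K : Set E}
    (hK : IsCompact K) {x : E} {r η : ℝ} (hη : 0 < η) (hr : ∀ y ∈ K, r ≤ dist y x) :
    ∃ γ > 0, ∀ y ∈ K, dist y x < r + γ → ∃ a ∈ K, dist a x = r ∧ dist y a < η := by
  set C := K \ ⋃ a ∈ {a ∈ K | dist a x = r}, Metric.ball a η with hC
  have hCc : IsCompact C := hK.diff (isOpen_biUnion fun a _ => Metric.isOpen_ball)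
  rcases C.eq_empty_or_nonempty with hemp | hne
  · refine ⟨1, one_pos, fun y hy _ => ?_⟩
    by_contra! h
    have : y ∈ C := ⟨hy, by
      simp only [Set.mem_iUnion, Metric.mem_ball, not_exists, not_lt]
      exact fun a ha => h a ha.1 ha.2⟩
    rw [hemp] at this
    exact this
  · obtain ⟨c, hc, hmin⟩ := hCc.exists_isMinOn hne (f := fun y => dist y x) (by fun_prop)
    have hrc : r < dist c x := by
      refine lt_of_le_of_ne (hr c hc.1) fun h => hc.2 ?_
      simp only [Set.mem_iUnion]
      exact ⟨c, ⟨hc.1, h.symm⟩, Metric.mem_ball_self hη⟩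
    refine ⟨dist c x - r, sub_pos.2 hrc, fun y hy hlt => ?_⟩
    by_contra! h
    have hyC : y ∈ C := ⟨hy, by
      simp only [Set.mem_iUnion, Metric.mem_ball, not_exists, not_lt]
      exact fun a ha => h a ha.1 ha.2⟩
    have : dist c x ≤ dist y x := hmin hyC
    linarith

/-- A critical point with critical value below `r`, close enough to a point `x` at distance `r`
having finitely many nearest points, has a nearest point lying below the tangent hyperplane of
the ball around `x` at one of the nearest points of `x`. -/
theorem exists_near_below {E : Type*} [NormedAddCommGroup E] [InnerProductSpace ℝ E] {K : Set E}
    (hK : IsCompact K) {x : E} {r : ℝ} (hx : Metric.infDist x K = r)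
    (hN : {a ∈ K | dist a x = r}.Finite) {η : ℝ} (hη : 0 < η) :
    ∃ γ > 0, ∀ y s, s < r → dist y x < γ → Metric.infDist y K = s →
      y ∈ convexHull ℝ {b ∈ K | Metric.infDist y K = dist y b} →
      ∃ a ∈ {a ∈ K | dist a x = r}, ∃ b ∈ K, ‖b - a‖ < η ∧ 0 < inner ℝ (a - b) (a - x) := by
  obtain ⟨γ₁, hγ₁, hhull⟩ := hN.exists_pos_forall_mem_convexHull x
  obtain ⟨γ₂, hγ₂, hnear⟩ := hK.exists_pos_forall_dist_lt (x := x) (r := r)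
    (η := min η (γ₁ / 2)) (by positivity) (fun y hy => by
      rw [dist_comm, ← hx]; exact Metric.infDist_le_dist_of_mem hy)
  refine ⟨min γ₂ (γ₁ / 2), by positivity, fun y s hs hyx hys hy => ?_⟩
  have hyx₁ := hyx.trans_le (min_le_left _ _)
  have hyx₂ := hyx.trans_le (min_le_right _ _)
  set A : Set E := {a | (a ∈ K ∧ dist a x = r) ∧
    ∃ b ∈ K, dist y b = s ∧ dist b a < min η (γ₁ / 2)} with hA
  have hyA : y ∈ Metric.thickening (γ₁ / 2) (convexHull ℝ A) := by
    refine convexHull_min ?_ ((convex_convexHull ℝ A).thickening _) hy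
    rintro b ⟨hbK, hb⟩
    rw [hys] at hb
    obtain ⟨a, haK, har, hba⟩ := hnear b hbK (by
      have := dist_triangle b y x
      rw [dist_comm b y, ← hb] at this
      linarith)
    exact Metric.mem_thickening_iff.2 ⟨a, subset_convexHull ℝ A ⟨⟨haK, har⟩, b, hbK, hb.symm, hba⟩,
      hba.trans_le (min_le_right _ _)⟩
  have hxA : x ∈ convexHull ℝ A := by
    refine hhull A (fun a ha => ha.1) ?_
    obtain ⟨w, hw, hyw⟩ := Metric.mem_thickening_iff.1 hyA
    refine Metric.mem_thickening_iff.2 ⟨w, hw, ?_⟩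
    have := dist_triangle x y w
    rw [dist_comm x y] at this
    linarith
  obtain ⟨a, ⟨haN, b, hbK, hyb, hba⟩, hle⟩ :=
    exists_inner_sub_nonpos_of_mem_convexHull hxA (y - x)
  refine ⟨a, haN, b, hbK, by rw [← dist_eq_norm]; exact hba.trans_le (min_le_left _ _), ?_⟩
  have hr0 : 0 ≤ r := hx ▸ Metric.infDist_nonneg
  have har : ‖a - x‖ = r := by rw [← dist_eq_norm]; exact haN.2
  have hs0 : 0 ≤ s := hys ▸ Metric.infDist_nonneg
  have hsplit : inner ℝ (a - b) (a - x) =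
      ‖a - x‖ ^ 2 - inner ℝ (a - x) (y - x) - inner ℝ (b - y) (a - x) := by
    rw [← real_inner_self_eq_norm_sq, real_inner_comm (y - x) (a - x), ← inner_sub_left,
      ← inner_sub_left]
    congr 1; abel
  have hcs := real_inner_le_norm (b - y) (a - x)
  rw [← dist_eq_norm b y, dist_comm, hyb, har] at hcs
  rw [hsplit, har]
  nlinarith

/-- **Proposition.** Let `K ⊆ ℝⁿ` be a nonempty compact set such that `K ∩ closure S` is
finite for every open, strictly convex `S` with smooth boundary disjoint from `K`. Then for
every critical value `r > 0` of `K` there is `ε > 0` such that no number in `(r − ε, r)` is a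
critical value of `K`. -/
theorem stmt5 (n : ℕ) (hn : 1 ≤ n)
    (K : Set (EuclideanSpace ℝ (Fin n))) (hKc : IsCompact K) (hKne : K.Nonempty)
    (hfin : ∀ S : Set (EuclideanSpace ℝ (Fin n)), StrictlyConvexSmoothOpen S → S ∩ K = ∅ →
      (K ∩ closure S).Finite)
    (r : ℝ) (hr : 0 < r)
    (hcrit : ∃ x : EuclideanSpace ℝ (Fin n),
      x ∈ convexHull ℝ {a ∈ K | Metric.infDist x K = dist x a} ∧
      Metric.infDist x K = r) :
    ∃ ε : ℝ, 0 < ε ∧ ∀ s ∈ Set.Ioo (r - ε) r,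
      ¬ ∃ x : EuclideanSpace ℝ (Fin n),
        x ∈ convexHull ℝ {a ∈ K | Metric.infDist x K = dist x a} ∧
        Metric.infDist x K = s := by
  by_contra! hcon
  choose s hs x hx hxs using fun k : ℕ => hcon (1 / ((k : ℝ) + 1)) (by positivity)
  have hmem : ∀ k, x k ∈ convexHull ℝ K := fun k =>
    convexHull_mono (fun a ha => ha.1) (hx k)
  obtain ⟨x₀, -, ψ, hψ, hlim⟩ := tendsto_subseq_of_bounded
    (isBounded_convexHull.2 hKc.isBounded) hmem
  have hslim : Filter.Tendsto s Filter.atTop (nhds r) := by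
    refine tendsto_of_tendsto_of_tendsto_of_le_of_le (g := fun k : ℕ => r - 1 / ((k : ℝ) + 1))
      ?_ tendsto_const_nhds (fun k => (hs k).1.le) (fun k => (hs k).2.le)
    simpa using tendsto_const_nhds.sub (tendsto_one_div_add_atTop_nhds_zero_nat (𝕜 := ℝ))
  have hx₀ : Metric.infDist x₀ K = r := by
    have h1 : Filter.Tendsto (fun k => Metric.infDist (x (ψ k)) K) Filter.atTop
        (nhds (Metric.infDist x₀ K)) := (Metric.continuous_infDist_pt K).tendsto x₀ |>.comp hlim
    refine tendsto_nhds_unique h1 ?_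
    simp only [hxs]
    exact hslim.comp hψ.tendsto_atTop
  have hout : ∀ y ∈ K, r ≤ ‖y - x₀‖ := fun y hy => by
    rw [← dist_eq_norm, dist_comm, ← hx₀]; exact Metric.infDist_le_dist_of_mem hy
  have hN : {a ∈ K | dist a x₀ = r}.Finite := by
    have hmono : StrictMono (deriv fun s : ℝ => s ^ 2) := fun s t hst => by simpa using hst
    obtain ⟨hconv, hdiff⟩ := strictConvexOn_and_differentiable_radial (φ := fun s : ℝ => s ^ 2)
      (by fun_prop) hmono (by simp) x₀ 0 (r ^ 2)
    have hneg : ‖x₀ - x₀‖ ^ 2 - (inner ℝ (x₀ - x₀) 0 + r ^ 2) < 0 := by simp [hr]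
    refine (hfin _ (hconv.strictlyConvexSmoothOpen hdiff hneg) ?_).subset ?_
    · rw [Set.eq_empty_iff_forall_notMem]
      rintro y ⟨hy, hyK⟩
      have hy' : ‖y - x₀‖ ^ 2 - (inner ℝ (x₀ - y) 0 + r ^ 2) < 0 := hy
      rw [inner_zero_right] at hy'
      nlinarith [hout y hyK]
    · rintro a ⟨haK, ha⟩
      refine ⟨haK, hconv.le_zero_mem_closure_lt_zero hneg ?_⟩
      rw [dist_eq_norm] at ha
      simp [ha]
  have hnear : ∀ η > 0, ∃ a ∈ {a ∈ K | dist a x₀ = r}, ∃ b ∈ K,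
      ‖b - a‖ < η ∧ 0 < inner ℝ (a - b) (a - x₀) := by
    intro η hη
    obtain ⟨γ, hγ, h⟩ := exists_near_below hKc hx₀ hN hη
    obtain ⟨k, hk⟩ := ((Metric.tendsto_nhds.1 hlim) γ hγ).exists
    exact h (x (ψ k)) (s (ψ k)) (hs _).2 hk (hxs _) (hx _)
  obtain ⟨a, ha, hacc⟩ : ∃ a ∈ {a ∈ K | dist a x₀ = r}, ∀ η > 0, ∃ b ∈ K,
      ‖b - a‖ < η ∧ 0 < inner ℝ (a - b) (a - x₀) := by
    by_contra! h
    choose! η hη hηb using h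
    obtain ⟨a₁, ha₁, -⟩ := hnear 1 one_pos
    obtain ⟨a₂, ha₂, hmin⟩ := Set.exists_min_image _ η hN ⟨a₁, ha₁⟩
    obtain ⟨a, ha, b, hbK, hba, hpos⟩ := hnear (η a₂) (hη a₂ ha₂)
    exact hpos.not_ge (hηb a ha b hbK (hba.trans_le (hmin a ha)))
  obtain ⟨S, hS, hSK, hinf⟩ := exists_infinite_contact hKc (a := a) (e := a - x₀)
    (fun y hy hya => by
      have har : ‖a - x₀‖ = r := by rw [← dist_eq_norm]; exact ha.2
      have h1 : 0 < ‖y - a‖ := norm_pos_iff.2 (sub_ne_zero.2 hya)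
      have h2 := norm_sub_sq_real (a - x₀) (a - y)
      rw [sub_sub_sub_cancel_left, har, real_inner_comm, ← norm_neg (a - y), neg_sub] at h2
      nlinarith [hout y hy]) hacc
  exact hinf (hfin S hS hSK)
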